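/- arXiv:1512.00075 — 2 statements merged into one kernel-verified Lean document; each statement's English description precedes it below -/
import Mathlib

section
/- For every ε ∈ (0, 1/16] there exists a smooth measure-preserving (with respect to 2-dimensional Lebesgue measure) diffeomorphism g_ε : [0,1]² → {(x + ε·y, y) : x, y ∈ [0,1]} which equals the identity on [4ε, 1−4ε]² and coincides with the shear map (x, y) ↦ (x + ε·y, y) on [0,1]² \ [ε, 1−ε]². -/
open MeasureTheory Set

/-- A smooth contraction perturbs the identity to a smooth diffeomorphism. -/
theorem exists_diffeo_id_add {E : Type*} [NormedAddCommGroup E] [NormedSpace ℝ E]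
    [CompleteSpace E] {n : WithTop ℕ∞} (hn : n ≠ 0) {u : E → E} (hu : ContDiff ℝ n u)
    {c : NNReal} (hc : c < 1) (hL : LipschitzWith c u) :
    ∃ e : E ≃ₜ E, (∀ x, e x = x + u x) ∧ ContDiff ℝ n e ∧ ContDiff ℝ n e.symm := by
  have happ : ApproximatesLinearOn (fun x => x + u x)
      ((ContinuousLinearEquiv.refl ℝ E : E ≃L[ℝ] E) : E →L[ℝ] E) univ c := by
    intro x _ y _
    have h := hL.norm_sub_le x y
    rwa [show x + u x - (y + u y) - (ContinuousLinearEquiv.refl ℝ E : E →L[ℝ] E) (x - y) =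
      u x - u y by simp; abel]
  have hN : Subsingleton E ∨
      c < ‖((ContinuousLinearEquiv.refl ℝ E).symm : E →L[ℝ] E)‖₊⁻¹ := by
    rcases subsingleton_or_nontrivial E with h | h
    · exact Or.inl h
    · right
      have : ‖((ContinuousLinearEquiv.refl ℝ E).symm : E →L[ℝ] E)‖₊ = 1 :=
        NNReal.eq (ContinuousLinearMap.norm_id (𝕜 := ℝ) (E := E))
      rwa [this, inv_one]
  let e : E ≃ₜ E := happ.toHomeomorph _ hN
  have he : ∀ x, e x = x + u x := fun x => rfl
  have hsmooth : ContDiff ℝ n e := contDiff_id.add hu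
  have hlt : ∀ x, ‖-fderiv ℝ u x‖ < 1 := fun x => by
    rw [norm_neg]
    exact (norm_fderiv_le_of_lipschitz ℝ hL).trans_lt (by exact_mod_cast hc)
  refine ⟨e, he, hsmooth, e.contDiff_symm
    (f₀' := fun x => ContinuousLinearEquiv.ofUnit (Units.oneSub _ (hlt x))) (fun x => ?_) hsmooth⟩
  have h := (hasFDerivAt_id x).add (hu.differentiable hn x).hasFDerivAt
  have heq : ((ContinuousLinearEquiv.ofUnit (Units.oneSub _ (hlt x)) : E ≃L[ℝ] E) : E →L[ℝ] E) =
      ContinuousLinearMap.id ℝ E + fderiv ℝ u x := by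
    ext v
    change (1 - -fderiv ℝ u x) v = _
    simp
  rw [heq]
  exact h

/-- If two homeomorphisms have the same Jacobian, their quotient preserves Lebesgue measure. -/
theorem measurePreserving_symm_trans_of_det_eq {E : Type*} [NormedAddCommGroup E]
    [NormedSpace ℝ E] [FiniteDimensional ℝ E] [MeasurableSpace E] [BorelSpace E]
    (μ : Measure E) [μ.IsAddHaarMeasure] (e f : E ≃ₜ E) {e' f' : E → E →L[ℝ] E}
    (he : ∀ x, HasFDerivAt e (e' x) x) (hf : ∀ x, HasFDerivAt f (f' x) x)
    (hdet : ∀ x, (e' x).det = (f' x).det) :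
    MeasurePreserving (f.symm.trans e) μ μ := by
  refine ⟨(f.symm.trans e).continuous.measurable, ?_⟩
  ext s hs
  have hes : MeasurableSet (e ⁻¹' s) := e.continuous.measurable hs
  rw [Measure.map_apply (f.symm.trans e).continuous.measurable hs]
  have hpre : (f.symm.trans e) ⁻¹' s = f '' (e ⁻¹' s) := by
    rw [f.image_eq_preimage_symm]
    rfl
  rw [hpre, ← lintegral_abs_det_fderiv_eq_addHaar_image μ hes
    (fun x _ => (hf x).hasFDerivWithinAt) f.injective.injOn]
  simp_rw [← hdet]
  rw [lintegral_abs_det_fderiv_eq_addHaar_image μ hes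
    (fun x _ => (he x).hasFDerivWithinAt) e.injective.injOn, image_preimage_eq _ e.surjective]

/-- The determinant of a rank-one perturbation of the identity. -/
theorem det_id_add_smulRight {E : Type*} [NormedAddCommGroup E] [NormedSpace ℝ E]
    [FiniteDimensional ℝ E] (l : E →L[ℝ] ℝ) (v : E) :
    (ContinuousLinearMap.id ℝ E + l.smulRight v).det = 1 + l v := by
  exact LinearMap.transvection.det (l : E →ₗ[ℝ] ℝ) v

/-- The Hamiltonian `δ y² / 2 - a(x) c(y)`, scaled by a small step `1 / n` and used as a generating
function in the mixed variables, defines an area-preserving diffeomorphism of the plane. -/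
theorem exists_symplecticEuler_step {a c : ℝ → ℝ} (ha : ContDiff ℝ (⊤ : ℕ∞) a)
    (hc : ContDiff ℝ (⊤ : ℕ∞) c) (has : HasCompactSupport a) (hcs : HasCompactSupport c) (δ : ℝ) :
    ∃ n : ℕ, 0 < n ∧ ∃ G : (ℝ × ℝ) ≃ₜ (ℝ × ℝ),
      ContDiff ℝ (⊤ : ℕ∞) G ∧ ContDiff ℝ (⊤ : ℕ∞) G.symm ∧ MeasurePreserving G volume volume ∧
      ∀ x y : ℝ, G (x, y - (n : ℝ)⁻¹ * (deriv a x * c y)) =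
        (x + (n : ℝ)⁻¹ * (δ * y - a x * deriv c y), y) := by
  have ha' : ContDiff ℝ (⊤ : ℕ∞) (deriv a) := ha.iterate_deriv 1
  have hc' : ContDiff ℝ (⊤ : ℕ∞) (deriv c) := hc.iterate_deriv 1
  have hprod : ∀ {f g : ℝ → ℝ}, ContDiff ℝ (⊤ : ℕ∞) f → ContDiff ℝ (⊤ : ℕ∞) g →
      HasCompactSupport f → HasCompactSupport g →
      ∃ K, LipschitzWith K (fun p : ℝ × ℝ => f p.1 * g p.2) := by
    intro f g hf hg hfs hgs
    refine ⟨_, (ContDiff.lipschitzWith_of_hasCompactSupport (n := (⊤ : ℕ∞)) ?_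
      (by fun_prop) (by simp)).choose_spec⟩
    refine HasCompactSupport.intro (hfs.prod hgs) fun p hp => ?_
    by_contra h
    exact hp ⟨subset_tsupport _ (left_ne_zero_of_mul h), subset_tsupport _ (right_ne_zero_of_mul h)⟩
  obtain ⟨K₁, hK₁⟩ := hprod ha' hc has.deriv hcs
  obtain ⟨K₂, hK₂⟩ := hprod ha hc' has hcs.deriv
  obtain ⟨n, hn⟩ := exists_nat_gt (K₁ + (‖δ‖₊ + K₂) : NNReal)
  have hn0 : (0 : NNReal) < n := lt_of_le_of_lt zero_le hn
  set t : ℝ := (n : ℝ)⁻¹ with ht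
  have htn : ‖t‖₊ = (n : NNReal)⁻¹ := by simp [ht]
  have hcontr : ∀ K : NNReal, K ≤ K₁ + (‖δ‖₊ + K₂) → ‖t‖₊ * K < 1 := by
    intro K hK
    rw [htn, inv_mul_lt_iff₀ hn0, mul_one]
    exact hK.trans_lt hn
  let l : ℝ × ℝ → ℝ := fun p => -(t * (deriv a p.1 * c p.2))
  let m : ℝ × ℝ → ℝ := fun p => t * (δ * p.2 - a p.1 * deriv c p.2)
  have hl : LipschitzWith (‖t‖₊ * K₁) l := (((lipschitzWith_smul t).comp hK₁)).neg
  have hm : LipschitzWith (‖t‖₊ * (‖δ‖₊ + K₂)) m := by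
    refine (lipschitzWith_smul t).comp (LipschitzWith.sub ?_ hK₂)
    have h := (lipschitzWith_smul δ).comp (LipschitzWith.prod_snd (α := ℝ) (β := ℝ))
    rwa [mul_one] at h
  have hls : ContDiff ℝ (⊤ : ℕ∞) l := by fun_prop
  have hms : ContDiff ℝ (⊤ : ℕ∞) m := by fun_prop
  obtain ⟨f, hf, hfs', hfs⟩ := exists_diffeo_id_add (n := (⊤ : ℕ∞)) (by simp)
    (u := fun p : ℝ × ℝ => ((0 : ℝ), l p)) (by fun_prop) (hcontr K₁ (by simp))
    (by simpa using (LipschitzWith.const (0 : ℝ)).prodMk hl)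
  obtain ⟨e, he, hes, hes'⟩ := exists_diffeo_id_add (n := (⊤ : ℕ∞)) (by simp)
    (u := fun p : ℝ × ℝ => (m p, (0 : ℝ))) (by fun_prop) (hcontr (‖δ‖₊ + K₂) (by simp))
    (by simpa using hm.prodMk (LipschitzWith.const (0 : ℝ)))
  have hda := fun x => (ha.differentiable (by simp) x).hasDerivAt
  have hdc := fun x => (hc.differentiable (by simp) x).hasDerivAt
  have hda' := fun x => (ha'.differentiable (by simp) x).hasDerivAt
  have hdc' := fun x => (hc'.differentiable (by simp) x).hasDerivAt
  have hfst := fun p : ℝ × ℝ => (ContinuousLinearMap.fst ℝ ℝ ℝ).hasFDerivAt (x := p)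
  have hsnd := fun p : ℝ × ℝ => (ContinuousLinearMap.snd ℝ ℝ ℝ).hasFDerivAt (x := p)
  have hdl := fun p : ℝ × ℝ => ((((hda' p.1).comp_hasFDerivAt p (hfst p)).mul
    ((hdc p.2).comp_hasFDerivAt p (hsnd p))).const_mul t).neg
  have hdm := fun p : ℝ × ℝ => (((hsnd p).const_mul δ).sub
    (((hda p.1).comp_hasFDerivAt p (hfst p)).mul
    ((hdc' p.2).comp_hasFDerivAt p (hsnd p)))).const_mul t
  have hdf : ∀ p, HasFDerivAt f (ContinuousLinearMap.id ℝ (ℝ × ℝ) +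
      (fderiv ℝ l p).smulRight ((0 : ℝ), (1 : ℝ))) p := by
    intro p
    have h := (hasFDerivAt_id p).add
      ((hasFDerivAt_const (0 : ℝ) p).prodMk (hls.differentiable (by simp) p).hasFDerivAt)
    refine (h.congr_of_eventuallyEq (.of_forall hf)).congr_fderiv ?_
    ext <;> simp
  have hde : ∀ p, HasFDerivAt e (ContinuousLinearMap.id ℝ (ℝ × ℝ) +
      (fderiv ℝ m p).smulRight ((1 : ℝ), (0 : ℝ))) p := by
    intro p
    have h := (hasFDerivAt_id p).add
      ((hms.differentiable (by simp) p).hasFDerivAt.prodMk (hasFDerivAt_const (0 : ℝ) p))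
    refine (h.congr_of_eventuallyEq (.of_forall he)).congr_fderiv ?_
    ext <;> simp
  refine ⟨n, by exact_mod_cast hn0, f.symm.trans e, hes.comp hfs, ?_,
    measurePreserving_symm_trans_of_det_eq _ e f hde hdf fun p => ?_, fun x y => ?_⟩
  · exact hfs'.comp hes'
  · rw [det_id_add_smulRight, det_id_add_smulRight]
    have hl' : fderiv ℝ l p = _ := (hdl p).fderiv
    have hm' : fderiv ℝ m p = _ := (hdm p).fderiv
    simp [hl', hm', mul_comm]
  · have h : f (x, y) = (x, y - t * (deriv a x * c y)) := by
      simp [hf, l, sub_eq_add_neg]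
    change e (f.symm _) = _
    rw [← h, f.symm_apply_apply, he]
    simp [m, ht]

/-- For every `ε ∈ (0, 1/16]` there exists a smooth measure-preserving
diffeomorphism `g_ε` of the plane mapping the unit square `[0,1]²` onto the sheared
square `{(x + ε·y, y) : x, y ∈ [0,1]}`, equal to the identity on `[4ε, 1−4ε]²` and
coinciding with the shear `(x,y) ↦ (x + ε·y, y)` on `[0,1]² \ [ε, 1−ε]²`. -/
theorem stmt5 (ε : ℝ) (hε0 : 0 < ε) (hε : ε ≤ 1 / 16) :
    ∃ g g' : ℝ × ℝ → ℝ × ℝ,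
      ContDiff ℝ (⊤ : ℕ∞) g ∧ ContDiff ℝ (⊤ : ℕ∞) g' ∧
      Function.LeftInverse g' g ∧ Function.RightInverse g' g ∧
      MeasurePreserving g volume volume ∧
      g '' (Icc 0 1 ×ˢ Icc 0 1) =
        (fun p : ℝ × ℝ => (p.1 + ε * p.2, p.2)) '' (Icc 0 1 ×ˢ Icc 0 1) ∧
      EqOn g id (Icc (4 * ε) (1 - 4 * ε) ×ˢ Icc (4 * ε) (1 - 4 * ε)) ∧
      ∀ p ∈ (Icc (0:ℝ) 1 ×ˢ Icc (0:ℝ) 1) \ (Icc ε (1 - ε) ×ˢ Icc ε (1 - ε)),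
        g p = (p.1 + ε * p.2, p.2) := by
  let b : ContDiffBump (1 / 2 : ℝ) :=
    { rIn := 1 / 2 - 7 / 2 * ε
      rOut := 1 / 2 - 5 / 2 * ε
      rIn_pos := by linarith
      rIn_lt_rOut := by linarith }
  have hb : ContDiff ℝ (⊤ : ℕ∞) b := b.contDiff
  have hb_one : ∀ x ∈ Icc (4 * ε) (1 - 4 * ε), b =ᶠ[nhds x] 1 := fun x hx =>
    b.eventuallyEq_one_of_mem_ball <| by
      rw [Metric.mem_ball, Real.dist_eq, abs_lt]
      constructor <;> simp only [b] <;> linarith [hx.1, hx.2]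
  have hb_zero : ∀ x, x ≤ 2 * ε ∨ 1 - 2 * ε ≤ x → b =ᶠ[nhds x] 0 := fun x hx => by
    rw [← notMem_tsupport_iff_eventuallyEq, b.tsupport_eq, Metric.mem_closedBall, Real.dist_eq,
      abs_le]
    simp only [b]
    rintro ⟨h₁, h₂⟩
    rcases hx with hx | hx <;> linarith
  let c : ℝ → ℝ := fun y => ε / 2 * y ^ 2 * b y
  have hc : ContDiff ℝ (⊤ : ℕ∞) c := by fun_prop
  have hc_zero : ∀ y, y ≤ 2 * ε ∨ 1 - 2 * ε ≤ y → c =ᶠ[nhds y] 0 := fun y hy => by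
    filter_upwards [hb_zero y hy] with z hz
    simp [c, hz]
  have hc_deriv : ∀ y ∈ Icc (4 * ε) (1 - 4 * ε), deriv c y = ε * y := fun y hy => by
    have : c =ᶠ[nhds y] fun y => ε / 2 * y ^ 2 := by
      filter_upwards [hb_one y hy] with z hz
      simp [c, hz]
    rw [this.deriv_eq]
    simp
    ring
  obtain ⟨n, hn, G, hG, hG', hGm, hGe⟩ := exists_symplecticEuler_step hb hc b.hasCompactSupport
    b.hasCompactSupport.mul_left ε
  have hG_shear : ∀ x y, (x ≤ 2 * ε ∨ 1 - 2 * ε ≤ x) ∨ (y ≤ 2 * ε ∨ 1 - 2 * ε ≤ y) →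
      G (x, y) = (x + (n : ℝ)⁻¹ * (ε * y), y) := by
    intro x y hxy
    have h := hGe x y
    rcases hxy with hx | hy
    · simpa [(hb_zero x hx).deriv_eq, (hb_zero x hx).eq_of_nhds] using h
    · simpa [(hc_zero y hy).deriv_eq, (hc_zero y hy).eq_of_nhds] using h
  have hG_id : EqOn G id (Icc (4 * ε) (1 - 4 * ε) ×ˢ Icc (4 * ε) (1 - 4 * ε)) := by
    rintro ⟨x, y⟩ ⟨hx, hy⟩
    simpa [(hb_one x hx).deriv_eq, (hb_one x hx).eq_of_nhds, hc_deriv y hy] using hGe x y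
  have hshear_iter : ∀ x y, (x, y) ∉ Icc ε (1 - ε) ×ˢ Icc ε (1 - ε) → ∀ k ≤ n,
      G^[k] (x, y) = (x + k * ((n : ℝ)⁻¹ * (ε * y)), y) := by
    intro x y hxy k
    induction k with
    | zero => simp
    | succ k ih =>
      intro hk
      rw [Function.iterate_succ_apply', ih (by omega), hG_shear]
      · push_cast
        ring_nf
      · by_cases hy : y ∈ Icc ε (1 - ε)
        · left
          have hx : ¬ (ε ≤ x ∧ x ≤ 1 - ε) := fun hx => hxy ⟨hx, hy⟩
          have hkn : (k : ℝ) * (n : ℝ)⁻¹ ≤ 1 := by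
            rw [← div_eq_mul_inv]
            exact div_le_one_of_le₀ (by exact_mod_cast (by omega)) (by positivity)
          have hy0 : 0 ≤ ε * y := mul_nonneg hε0.le (hε0.le.trans hy.1)
          have hlow : 0 ≤ (k : ℝ) * ((n : ℝ)⁻¹ * (ε * y)) := by positivity
          have hupp : (k : ℝ) * ((n : ℝ)⁻¹ * (ε * y)) ≤ ε := by
            rw [← mul_assoc]
            exact (mul_le_of_le_one_left hy0 hkn).trans
              (mul_le_of_le_one_right hε0.le (by linarith [hy.2]))
          by_cases hx0 : ε ≤ x
          · right
            have : ¬ x ≤ 1 - ε := fun h => hx ⟨hx0, h⟩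
            linarith
          · left
            linarith
        · right
          by_cases hy0 : ε ≤ y
          · right
            have : ¬ y ≤ 1 - ε := fun h => hy ⟨hy0, h⟩
            linarith
          · left
            linarith
  have hshear : ∀ p ∉ Icc ε (1 - ε) ×ˢ Icc ε (1 - ε), G^[n] p = (p.1 + ε * p.2, p.2) := by
    rintro ⟨x, y⟩ hp
    rw [hshear_iter x y hp n le_rfl, mul_inv_cancel_left₀ (by positivity)]
  have hiter : ∀ {f : ℝ × ℝ → ℝ × ℝ}, ContDiff ℝ (⊤ : ℕ∞) f → ∀ k : ℕ,
      ContDiff ℝ (⊤ : ℕ∞) f^[k] := by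
    intro f hf k
    induction k with
    | zero => exact contDiff_id
    | succ k ih => exact ih.comp hf
  refine ⟨G^[n], G.symm^[n], hiter hG n, hiter hG' n,
    Function.LeftInverse.iterate G.symm_apply_apply n,
    Function.RightInverse.iterate G.apply_symm_apply n, hGm.iterate n, ?_,
    fun p hp => Function.iterate_fixed (hG_id hp) n, fun p hp => hshear p hp.2⟩
  have hbij : Function.Bijective (fun p : ℝ × ℝ => (p.1 + ε * p.2, p.2)) := by
    refine Function.bijective_iff_has_inverse.2 ⟨fun p => (p.1 - ε * p.2, p.2), ?_, ?_⟩ <;>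
      intro p <;> simp
  rw [← compl_inj_iff, ← image_compl_eq (G.bijective.iterate n), ← image_compl_eq hbij]
  refine image_congr fun p hp => hshear p fun hp' => hp ?_
  exact prod_mono (Icc_subset_Icc hε0.le (by linarith)) (Icc_subset_Icc hε0.le (by linarith)) hp'
end

section
/- For every ε ∈ (0, 1/4) and indices i ≠ j in {1, …, m} there exists a smooth measure-preserving diffeomorphism φ_{ε,i,j} of ℝ^m which equals the rotation in the x_i–x_j plane by angle π/2 about the center point (1/2, …, 1/2) on the cube [2ε, 1−2ε]^m and equals the identity outside of [ε, 1−ε]^m. -/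
open MeasureTheory Set Function

/-- A fibrewise expanding smooth family of real functions has a jointly smooth fibrewise inverse. -/
theorem exists_contDiff_fiberwise_inverse {A D : ℝ → ℝ → ℝ}
    (hA : ContDiff ℝ (⊤ : ℕ∞) (uncurry A)) (hD : ∀ w θ, HasDerivAt (A w) (D w θ) θ)
    (hD1 : ∀ w θ, 1 ≤ D w θ) :
    ∃ B : ℝ → ℝ → ℝ, ContDiff ℝ (⊤ : ℕ∞) (uncurry B) ∧ (∀ w θ, B w (A w θ) = θ) ∧
      ∀ w u, A w (B w u) = u := by
  have expand : ∀ w x y, x ≤ y → y - x ≤ A w y - A w x := by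
    intro w x y hxy
    have := mul_sub_le_image_sub_of_le_deriv (f := A w) (C := 1)
      (fun θ => (hD w θ).differentiableAt) (fun θ => by rw [(hD w θ).deriv]; exact hD1 w θ) hxy
    linarith
  have expand_abs : ∀ w x y, |x - y| ≤ |A w x - A w y| := by
    intro w x y
    rcases le_total x y with h | h
    · have := expand w x y h
      rw [abs_sub_comm x, abs_sub_comm (A w x), abs_of_nonneg (by linarith)]
      exact this.trans (le_abs_self _)
    · have := expand w y x h
      rw [abs_of_nonneg (by linarith)]
      exact this.trans (le_abs_self _)
  have surj : ∀ w, Surjective (A w) := by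
    intro w
    refine Continuous.surjective
      (continuous_iff_continuousAt.2 fun θ => (hD w θ).continuousAt) ?_ ?_
    · refine Filter.tendsto_atTop_mono' _ ?_
        (Filter.tendsto_atTop_add_const_right _ (A w 0) Filter.tendsto_id)
      filter_upwards [Filter.eventually_ge_atTop 0] with x hx
      have := expand w 0 x hx
      simp only [id]; linarith
    · refine Filter.tendsto_atBot_mono' _ ?_
        (Filter.tendsto_atBot_add_const_right _ (A w 0) Filter.tendsto_id)
      filter_upwards [Filter.eventually_le_atBot 0] with x hx
      have := expand w x 0 hx
      simp only [id]; linarith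
  choose B hB using surj
  have hBA : ∀ w θ, B w (A w θ) = θ := by
    intro w θ
    have := expand_abs w (B w (A w θ)) θ
    rw [hB, sub_self, abs_zero] at this
    exact sub_eq_zero.1 (abs_nonpos_iff.1 this)
  have hBc : Continuous (uncurry B) := by
    rw [continuous_iff_continuousAt]
    rintro ⟨w₀, u₀⟩
    have hlim : Filter.Tendsto (fun p : ℝ × ℝ => |p.2 - A p.1 (B w₀ u₀)|) (nhds (w₀, u₀))
        (nhds 0) := by
      have hc : Continuous fun p : ℝ × ℝ => |p.2 - A p.1 (B w₀ u₀)| := by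
        have := hA.continuous.comp (continuous_fst.prodMk (continuous_const (y := B w₀ u₀))
          : Continuous fun p : ℝ × ℝ => (p.1, B w₀ u₀))
        exact (continuous_snd.sub this).abs
      simpa [hB] using hc.tendsto (w₀, u₀)
    rw [ContinuousAt, tendsto_iff_dist_tendsto_zero]
    refine squeeze_zero (fun _ => dist_nonneg) (fun p => ?_) hlim
    have := expand_abs p.1 (B p.1 p.2) (B w₀ u₀)
    rw [hB] at this
    simpa [Real.dist_eq, uncurry] using this
  let e : ℝ × ℝ ≃ₜ ℝ × ℝ :=
    { toFun := fun p => (p.1, A p.1 p.2)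
      invFun := fun p => (p.1, B p.1 p.2)
      left_inv := fun p => by simp [hBA]
      right_inv := fun p => by simp [hB]
      continuous_toFun := continuous_fst.prodMk hA.continuous
      continuous_invFun := continuous_fst.prodMk hBc }
  have he : ContDiff ℝ (⊤ : ℕ∞) e := contDiff_fst.prodMk hA
  have hD0 : ∀ w θ, D w θ ≠ 0 := fun w θ => by linarith [hD1 w θ]
  have hsymm : ContDiff ℝ (⊤ : ℕ∞) e.symm := by
    refine e.contDiff_symm (f₀' := fun p => ContinuousLinearEquiv.skewProd
      (ContinuousLinearEquiv.refl ℝ ℝ)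
      (ContinuousLinearEquiv.unitsEquivAut ℝ (Units.mk0 (D p.1 p.2) (hD0 _ _)))
      ((fderiv ℝ (uncurry A) p).comp (ContinuousLinearMap.inl ℝ ℝ ℝ))) (fun p => ?_) he
    have hAp : HasFDerivAt (uncurry A) (fderiv ℝ (uncurry A) p) p :=
      (hA.differentiable (by simp) p).hasFDerivAt
    have hp : fderiv ℝ (uncurry A) p (0, 1) = D p.1 p.2 := by
      have hline : HasDerivAt (fun θ : ℝ => (p.1, θ)) ((0 : ℝ), (1 : ℝ)) p.2 :=
        (hasDerivAt_const _ _).prodMk (hasDerivAt_id _)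
      have := HasFDerivAt.comp_hasDerivAt p.2 (f := fun θ : ℝ => (p.1, θ)) hAp hline
      exact this.unique (hD p.1 p.2)
    have := (hasFDerivAt_fst (𝕜 := ℝ) (p := p)).prodMk hAp
    refine this.congr_fderiv ?_
    ext <;> simp [hp, ← Prod.zero_eq_mk]
  exact ⟨B, contDiff_snd.comp hsymm, hBA, hB⟩

theorem ContinuousLinearMap.det_complex (L : ℂ →L[ℝ] ℂ) :
    L.det = (L 1).re * (L Complex.I).im - (L Complex.I).re * (L 1).im := by
  rw [ContinuousLinearMap.det, ← LinearMap.det_toMatrix Complex.basisOneI, Matrix.det_fin_two]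
  simp [LinearMap.toMatrix_apply]

/-- A function of `(w, ζ)` that is `2πi`-periodic in `ζ` descends along the exponential
to a smooth function on the punctured plane. -/
theorem contDiffAt_comp_log {H : ℝ → ℂ → ℂ} (hH : ContDiff ℝ (⊤ : ℕ∞) (uncurry H))
    (hper : ∀ w, Periodic (H w) (2 * Real.pi * Complex.I)) {p : ℝ × ℂ} (hp : p.2 ≠ 0) :
    ContDiffAt ℝ (⊤ : ℕ∞) (fun p : ℝ × ℂ => H p.1 (Complex.log p.2)) p := by
  by_cases hs : p.2 ∈ Complex.slitPlane
  · have hlog : ContDiffAt ℝ (⊤ : ℕ∞) (fun p : ℝ × ℂ => Complex.log p.2) p :=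
      ((Complex.contDiffAt_log hs).restrict_scalars ℝ).comp p contDiffAt_snd
    exact hH.contDiffAt.comp p (contDiffAt_fst.prodMk hlog)
  · have hs' : -p.2 ∈ Complex.slitPlane := by
      rw [Complex.mem_slitPlane_iff] at hs ⊢
      push Not at hs
      left
      rcases hs.1.lt_or_eq with h | h
      · simpa using h
      · exact absurd (Complex.ext h hs.2) hp
    have hlog : ContDiffAt ℝ (⊤ : ℕ∞)
        (fun p : ℝ × ℂ => Complex.log (-p.2) + Real.pi * Complex.I) p :=
      (((Complex.contDiffAt_log hs').restrict_scalars ℝ).comp p contDiffAt_snd.neg).add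
        contDiffAt_const
    refine (hH.contDiffAt.comp p (contDiffAt_fst.prodMk hlog)).congr_of_eventuallyEq ?_
    filter_upwards [(isOpen_ne.preimage continuous_snd).mem_nhds hp] with x hx
    have hx : x.2 ≠ 0 := hx
    have : Complex.exp (Complex.log x.2)
        = Complex.exp (Complex.log (-x.2) + Real.pi * Complex.I) := by
      rw [Complex.exp_add, Complex.exp_log hx, Complex.exp_log (neg_ne_zero.2 hx),
        Complex.exp_pi_mul_I]
      ring
    obtain ⟨n, hn⟩ := Complex.exp_eq_exp_iff_exists_int.1 this
    simp only [comp, uncurry, hn]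
    exact (hper x.1).int_mul n _

/-- A smooth bijection of the plane with Jacobian `1` preserves Lebesgue measure. -/
theorem measurePreserving_of_det_eq_one {f g : ℂ → ℂ} (hf : ContDiff ℝ (⊤ : ℕ∞) f)
    (hg : ContDiff ℝ (⊤ : ℕ∞) g) (hgf : LeftInverse g f) (hfg : RightInverse g f)
    (hdet : ∀ z, z ≠ 0 → (fderiv ℝ g z).det = 1) : MeasurePreserving f volume volume := by
  have hdet' : ∀ z, (fderiv ℝ g z).det = 1 := by
    have hc : Continuous fun z => (fderiv ℝ g z).det :=
      ContinuousLinearMap.continuous_det.comp (hg.continuous_fderiv (by simp))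
    exact congrFun (hc.ext_on (dense_compl_singleton (0 : ℂ)) continuous_const hdet)
  refine ⟨hf.continuous.measurable, Measure.ext fun s hs => ?_⟩
  rw [Measure.map_apply hf.continuous.measurable hs, ← image_eq_preimage_of_inverse hfg hgf,
    ← lintegral_abs_det_fderiv_eq_addHaar_image volume hs
      (fun z _ => (hg.differentiable (by simp) z).hasFDerivAt.hasFDerivWithinAt) hfg.injective.injOn]
  simp [hdet']

/-- A family, indexed by `w`, of angular coordinates `A w` on the circle (lifted to `ℝ`), with
density `D w`, inverse `B w`, compatible with the rotation by `π / 2`. The associated area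
coordinates of the point with polar coordinates `(r, θ)` are `r ^ 2 / D w θ` and `A w θ`. -/
structure AngularChart where
  A : ℝ → ℝ → ℝ
  B : ℝ → ℝ → ℝ
  D : ℝ → ℝ → ℝ
  contDiff_A : ContDiff ℝ (⊤ : ℕ∞) (uncurry A)
  contDiff_B : ContDiff ℝ (⊤ : ℕ∞) (uncurry B)
  contDiff_D : ContDiff ℝ (⊤ : ℕ∞) (uncurry D)
  hasDerivAt_A : ∀ w θ, HasDerivAt (A w) (D w θ) θ
  B_A : ∀ w θ, B w (A w θ) = θ
  A_B : ∀ w u, A w (B w u) = u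
  one_le_D : ∀ w θ, 1 ≤ D w θ
  A_add : ∀ w θ, A w (θ + Real.pi / 2) = A w θ + A w (Real.pi / 2)
  D_add : ∀ w θ, D w (θ + Real.pi / 2) = D w θ

namespace AngularChart

variable (C : AngularChart) (T : ℝ → ℝ → ℝ)

theorem D_pos (w θ : ℝ) : 0 < C.D w θ := one_pos.trans_le (C.one_le_D w θ)

theorem B_add (w u : ℝ) : C.B w (u + C.A w (Real.pi / 2)) = C.B w u + Real.pi / 2 := by
  conv_lhs => rw [← C.A_B w u, ← C.A_add, C.B_A]

/-- The area coordinate of `exp ζ`. -/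
noncomputable def radius (w : ℝ) (ζ : ℂ) : ℝ := Real.exp (2 * ζ.re) / C.D w ζ.im

/-- The angle of the image of `exp ζ` under the twist with angular displacement `T`. -/
noncomputable def angle (w : ℝ) (ζ : ℂ) : ℝ := C.B w (C.A w ζ.im + T w (C.radius w ζ))

/-- The twist with angular displacement `T`, in logarithmic coordinates. -/
noncomputable def lift (w : ℝ) (ζ : ℂ) : ℂ :=
  ((ζ.re + (Real.log (C.D w (C.angle T w ζ)) - Real.log (C.D w ζ.im)) / 2 : ℝ) : ℂ) +
    (C.angle T w ζ : ℂ) * Complex.I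

/-- The twist with angular displacement `T`. -/
noncomputable def twist (w : ℝ) (z : ℂ) : ℂ :=
  if z = 0 then 0 else Complex.exp (C.lift T w (Complex.log z))

@[simp]
theorem lift_re (w : ℝ) (ζ : ℂ) : (C.lift T w ζ).re =
    ζ.re + (Real.log (C.D w (C.angle T w ζ)) - Real.log (C.D w ζ.im)) / 2 := by
  simp only [lift, Complex.add_re, Complex.ofReal_re, Complex.re_ofReal_mul, Complex.I_re]
  ring

@[simp]
theorem lift_im (w : ℝ) (ζ : ℂ) : (C.lift T w ζ).im = C.angle T w ζ := by
  simp only [lift, Complex.add_im, Complex.ofReal_im, Complex.im_ofReal_mul, Complex.I_im]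
  ring

theorem radius_lift (w : ℝ) (ζ : ℂ) : C.radius w (C.lift T w ζ) = C.radius w ζ := by
  have h₁ := C.D_pos w (C.angle T w ζ)
  have h₂ := C.D_pos w ζ.im
  rw [radius, radius, lift_re, lift_im]
  have : 2 * (ζ.re + (Real.log (C.D w (C.angle T w ζ)) - Real.log (C.D w ζ.im)) / 2) =
      2 * ζ.re + Real.log (C.D w (C.angle T w ζ)) - Real.log (C.D w ζ.im) := by ring
  rw [this, Real.exp_sub, Real.exp_add, Real.exp_log h₁, Real.exp_log h₂]
  field_simp

theorem A_angle (w : ℝ) (ζ : ℂ) :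
    C.A w (C.angle T w ζ) = C.A w ζ.im + T w (C.radius w ζ) := C.A_B _ _

theorem lift_neg_lift (w : ℝ) (ζ : ℂ) : C.lift (-T) w (C.lift T w ζ) = ζ := by
  have h : C.angle (-T) w (C.lift T w ζ) = ζ.im := by
    rw [angle, lift_im, A_angle, radius_lift]
    simp [C.B_A]
  apply Complex.ext
  · rw [lift_re, h, lift_re, lift_im]; ring
  · rw [lift_im, h]

theorem radius_add (w : ℝ) (ζ : ℂ) :
    C.radius w (ζ + (Real.pi / 2 : ℝ) * Complex.I) = C.radius w ζ := by
  simp [radius, -Complex.ofReal_div, C.D_add]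

theorem angle_add (w : ℝ) (ζ : ℂ) :
    C.angle T w (ζ + (Real.pi / 2 : ℝ) * Complex.I) = C.angle T w ζ + Real.pi / 2 := by
  rw [angle, radius_add, angle, ← B_add]
  simp only [Complex.add_im, Complex.im_ofReal_mul, Complex.I_im, mul_one, C.A_add]
  congr 1
  ring

theorem lift_add (w : ℝ) (ζ : ℂ) :
    C.lift T w (ζ + (Real.pi / 2 : ℝ) * Complex.I) =
      C.lift T w ζ + (Real.pi / 2 : ℝ) * Complex.I := by
  apply Complex.ext
  · simp [-Complex.ofReal_div, angle_add, C.D_add]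
  · simp [-Complex.ofReal_div, angle_add]

theorem lift_add_two_pi (w : ℝ) (ζ : ℂ) :
    C.lift T w (ζ + 2 * Real.pi * Complex.I) = C.lift T w ζ + 2 * Real.pi * Complex.I := by
  have : ∀ x : ℂ, x + 2 * Real.pi * Complex.I = x + (Real.pi / 2 : ℝ) * Complex.I +
      (Real.pi / 2 : ℝ) * Complex.I + (Real.pi / 2 : ℝ) * Complex.I +
      (Real.pi / 2 : ℝ) * Complex.I := by
    intro x; push_cast; ring
  rw [this, this, lift_add, lift_add, lift_add, lift_add]

theorem periodic_exp_lift (w : ℝ) :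
    Periodic (fun ζ => Complex.exp (C.lift T w ζ)) (2 * Real.pi * Complex.I) := fun ζ => by
  simp only [lift_add_two_pi, Complex.exp_periodic _]

theorem twist_exp (w : ℝ) (ζ : ℂ) :
    C.twist T w (Complex.exp ζ) = Complex.exp (C.lift T w ζ) := by
  rw [twist, if_neg (Complex.exp_ne_zero ζ)]
  obtain ⟨n, hn⟩ := Complex.exp_eq_exp_iff_exists_int.1 (Complex.exp_log (Complex.exp_ne_zero ζ))
  rw [hn]
  exact (C.periodic_exp_lift T w).int_mul n ζ

@[simp]
theorem twist_zero (w : ℝ) : C.twist T w 0 = 0 := if_pos rfl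

theorem twist_neg_twist (w : ℝ) (z : ℂ) : C.twist (-T) w (C.twist T w z) = z := by
  by_cases hz : z = 0
  · simp [hz]
  · obtain ⟨ζ, rfl⟩ : ∃ ζ, Complex.exp ζ = z := ⟨_, Complex.exp_log hz⟩
    rw [twist_exp, twist_exp, lift_neg_lift]

variable {T}

theorem contDiff_radius : ContDiff ℝ (⊤ : ℕ∞) (uncurry C.radius) := by
  have him : ContDiff ℝ (⊤ : ℕ∞) fun p : ℝ × ℂ => (p.1, p.2.im) :=
    contDiff_fst.prodMk (Complex.imCLM.contDiff.comp contDiff_snd)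
  have hre : ContDiff ℝ (⊤ : ℕ∞) fun p : ℝ × ℂ => p.2.re :=
    Complex.reCLM.contDiff.comp contDiff_snd
  exact (Real.contDiff_exp.comp (contDiff_const.mul hre)).div (C.contDiff_D.comp him)
    fun p => (C.D_pos _ _).ne'

theorem contDiff_angle (hT : ContDiff ℝ (⊤ : ℕ∞) (uncurry T)) :
    ContDiff ℝ (⊤ : ℕ∞) (uncurry (C.angle T)) := by
  have him : ContDiff ℝ (⊤ : ℕ∞) fun p : ℝ × ℂ => (p.1, p.2.im) :=
    contDiff_fst.prodMk (Complex.imCLM.contDiff.comp contDiff_snd)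
  exact C.contDiff_B.comp (contDiff_fst.prodMk ((C.contDiff_A.comp him).add
    (hT.comp (contDiff_fst.prodMk C.contDiff_radius))))

theorem contDiff_lift (hT : ContDiff ℝ (⊤ : ℕ∞) (uncurry T)) :
    ContDiff ℝ (⊤ : ℕ∞) (uncurry (C.lift T)) := by
  have him : ContDiff ℝ (⊤ : ℕ∞) fun p : ℝ × ℂ => (p.1, p.2.im) :=
    contDiff_fst.prodMk (Complex.imCLM.contDiff.comp contDiff_snd)
  have hre : ContDiff ℝ (⊤ : ℕ∞) fun p : ℝ × ℂ => p.2.re :=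
    Complex.reCLM.contDiff.comp contDiff_snd
  have ha := C.contDiff_angle hT
  have h₁ := (C.contDiff_D.comp (contDiff_fst.prodMk ha)).log fun p => (C.D_pos _ _).ne'
  have h₂ := (C.contDiff_D.comp him).log fun p => (C.D_pos _ _).ne'
  exact (Complex.ofRealCLM.contDiff.comp (hre.add ((h₁.sub h₂).div_const 2))).add
    ((Complex.ofRealCLM.contDiff.comp ha).mul contDiff_const)

theorem contDiffAt_twist (hT : ContDiff ℝ (⊤ : ℕ∞) (uncurry T)) {p : ℝ × ℂ} (hp : p.2 ≠ 0) :
    ContDiffAt ℝ (⊤ : ℕ∞) (uncurry (C.twist T)) p := by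
  refine (contDiffAt_comp_log (H := fun w ζ => Complex.exp (C.lift T w ζ)) ?_
    (C.periodic_exp_lift T) hp).congr_of_eventuallyEq ?_
  · exact Complex.contDiff_exp.comp (C.contDiff_lift hT)
  · filter_upwards [(isOpen_ne.preimage continuous_snd).mem_nhds hp] with x hx
    exact if_neg hx

/-- The area coordinates as a map of the plane: half the logarithm of the radial coordinate,
and the angular coordinate. -/
noncomputable def coord (w : ℝ) (ζ : ℂ) : ℂ :=
  ((ζ.re - Real.log (C.D w ζ.im) / 2 : ℝ) : ℂ) + (C.A w ζ.im : ℂ) * Complex.I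

theorem exp_coord_re (w : ℝ) (ζ : ℂ) : Real.exp (2 * (C.coord w ζ).re) = C.radius w ζ := by
  have : 2 * (C.coord w ζ).re = 2 * ζ.re - Real.log (C.D w ζ.im) := by simp [coord]; ring
  rw [this, Real.exp_sub, Real.exp_log (C.D_pos _ _), radius]

theorem coord_lift (w : ℝ) (ζ : ℂ) : C.coord w (C.lift T w ζ) =
    C.coord w ζ + (T w (Real.exp (2 * (C.coord w ζ).re)) : ℂ) * Complex.I := by
  rw [exp_coord_re]
  apply Complex.ext
  · simp [coord]; ring
  · simp [coord, A_angle]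

theorem differentiable_coord (w : ℝ) : Differentiable ℝ (C.coord w) := by
  have hA : Differentiable ℝ (C.A w) := fun θ => (C.hasDerivAt_A w θ).differentiableAt
  have hD : Differentiable ℝ (C.D w) :=
    (C.contDiff_D.comp (contDiff_const.prodMk contDiff_id)).differentiable (by simp)
  have him : Differentiable ℝ Complex.im := Complex.imCLM.differentiable
  have hre : Differentiable ℝ Complex.re := Complex.reCLM.differentiable
  have h : Differentiable ℝ fun ζ : ℂ => Real.log (C.D w ζ.im) / 2 := by
    simp_rw [div_eq_mul_inv]
    exact ((hD.comp him).log fun ζ => (C.D_pos w ζ.im).ne').mul_const _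
  exact (Complex.ofRealCLM.differentiable.comp (hre.sub h)).add
    ((Complex.ofRealCLM.differentiable.comp (hA.comp him)).mul_const _)

theorem det_fderiv_coord (w : ℝ) (ζ : ℂ) : (fderiv ℝ (C.coord w) ζ).det = C.D w ζ.im := by
  have hd := (C.differentiable_coord w ζ).hasFDerivAt
  have him : (Complex.imCLM.comp (fderiv ℝ (C.coord w) ζ)) = C.D w ζ.im • Complex.imCLM := by
    have h₁ := Complex.imCLM.hasFDerivAt.comp ζ hd
    have h₂ := (C.hasDerivAt_A w ζ.im).comp_hasFDerivAt ζ Complex.imCLM.hasFDerivAt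
    refine h₁.unique (h₂.congr_of_eventuallyEq (Filter.Eventually.of_forall fun x => ?_))
    simp [coord]
  have h1 : fderiv ℝ (C.coord w) ζ 1 = 1 := by
    have hline : HasDerivAt (fun t : ℝ => ζ + (t : ℂ)) 1 0 :=
      (Complex.ofRealCLM.hasDerivAt (x := 0)).const_add ζ
    have h₁ := HasFDerivAt.comp_hasDerivAt (0 : ℝ) (f := fun t : ℝ => ζ + (t : ℂ))
      (by simpa using hd) hline
    have h₂ : HasDerivAt (fun t : ℝ => C.coord w ζ + (t : ℂ)) 1 0 :=
      (Complex.ofRealCLM.hasDerivAt (x := 0)).const_add _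
    refine h₁.unique (h₂.congr_of_eventuallyEq (Filter.Eventually.of_forall fun t => ?_))
    simp [coord]; ring
  have hI := congrArg (fun L : ℂ →L[ℝ] ℝ => L Complex.I) him
  simp only [ContinuousLinearMap.comp_apply, Complex.imCLM_apply, _root_.smul_apply,
    Complex.I_im, smul_eq_mul, mul_one] at hI
  rw [ContinuousLinearMap.det_complex, h1, hI]
  simp

end AngularChart

theorem det_fderiv_shear {S : ℝ → ℝ} (hS : Differentiable ℝ S) (v : ℂ) :
    (fderiv ℝ (fun v : ℂ => v + (S v.re : ℂ) * Complex.I) v).det = 1 := by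
  have h : HasFDerivAt (fun v : ℂ => v + (S v.re : ℂ) * Complex.I)
      (ContinuousLinearMap.id ℝ ℂ +
        Complex.I • Complex.ofRealCLM.comp (deriv S v.re • Complex.reCLM)) v := by
    have h₁ := (hS v.re).hasDerivAt.comp_hasFDerivAt v Complex.reCLM.hasFDerivAt
    have h₂ := Complex.ofRealCLM.hasFDerivAt.comp v h₁
    exact (hasFDerivAt_id v).add (h₂.mul_const Complex.I)
  rw [h.fderiv, ContinuousLinearMap.det_complex]
  simp

theorem det_fderiv_exp (ζ : ℂ) :
    (fderiv ℝ Complex.exp ζ).det = Real.exp (2 * ζ.re) := by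
  have h := ((Complex.hasDerivAt_exp ζ).hasFDerivAt.restrictScalars ℝ)
  rw [h.fderiv, ContinuousLinearMap.det_complex]
  simp [Complex.exp_re, Complex.exp_im]
  rw [two_mul, Real.exp_add]
  linear_combination (Real.exp ζ.re) ^ 2 * Real.sin_sq_add_cos_sq ζ.im

theorem det_fderiv_comp {f g : ℂ → ℂ} {z : ℂ} (hg : DifferentiableAt ℝ g (f z))
    (hf : DifferentiableAt ℝ f z) :
    (fderiv ℝ (g ∘ f) z).det = (fderiv ℝ g (f z)).det * (fderiv ℝ f z).det := by
  rw [fderiv_comp z hg hf]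
  exact LinearMap.det_comp _ _

namespace AngularChart

variable (C : AngularChart) {T : ℝ → ℝ → ℝ}

theorem det_fderiv_lift (hT : ContDiff ℝ (⊤ : ℕ∞) (uncurry T)) (w : ℝ) (ζ : ℂ) :
    C.D w (C.angle T w ζ) * (fderiv ℝ (C.lift T w) ζ).det = C.D w ζ.im := by
  have hl : Differentiable ℝ (C.lift T w) :=
    ((C.contDiff_lift hT).comp (contDiff_const.prodMk contDiff_id)).differentiable (by simp)
  have hTw : Differentiable ℝ (T w) :=
    (hT.comp (contDiff_const.prodMk contDiff_id)).differentiable (by simp)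
  have hS : Differentiable ℝ fun x : ℝ => T w (Real.exp (2 * x)) :=
    hTw.comp (Real.differentiable_exp.comp (differentiable_id.const_mul 2))
  have hsh : Differentiable ℝ fun v : ℂ => v + (T w (Real.exp (2 * v.re)) : ℂ) * Complex.I :=
    differentiable_id.add ((Complex.ofRealCLM.differentiable.comp
      (hS.comp Complex.reCLM.differentiable)).mul_const _)
  have h := congrArg (fun f => (fderiv ℝ f ζ).det) (show C.coord w ∘ C.lift T w =
    (fun v : ℂ => v + (T w (Real.exp (2 * v.re)) : ℂ) * Complex.I) ∘ C.coord w from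
      funext fun ζ => C.coord_lift w ζ)
  simp only [det_fderiv_comp (C.differentiable_coord w _) (hl ζ),
    det_fderiv_comp (hsh _) (C.differentiable_coord w ζ)] at h
  rw [det_fderiv_coord, det_fderiv_coord, lift_im, det_fderiv_shear hS, one_mul] at h
  exact h

theorem det_fderiv_twist (hT : ContDiff ℝ (⊤ : ℕ∞) (uncurry T)) (w : ℝ) {z : ℂ} (hz : z ≠ 0) :
    (fderiv ℝ (C.twist T w) z).det = 1 := by
  obtain ⟨ζ, rfl⟩ : ∃ ζ, Complex.exp ζ = z := ⟨_, Complex.exp_log hz⟩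
  have hl : Differentiable ℝ (C.lift T w) :=
    ((C.contDiff_lift hT).comp (contDiff_const.prodMk contDiff_id)).differentiable (by simp)
  have htw : DifferentiableAt ℝ (C.twist T w) (Complex.exp ζ) :=
    ((C.contDiffAt_twist hT (p := (w, Complex.exp ζ)) hz).comp (Complex.exp ζ)
      (contDiffAt_const.prodMk contDiffAt_id)).differentiableAt (by simp)
  have hexp : Differentiable ℝ Complex.exp := Complex.differentiable_exp
  have h := congrArg (fun f => (fderiv ℝ f ζ).det) (show C.twist T w ∘ Complex.exp =
    Complex.exp ∘ C.lift T w from funext fun ζ => C.twist_exp T w ζ)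
  simp only [det_fderiv_comp htw (hexp ζ), det_fderiv_comp (hexp _) (hl ζ), det_fderiv_exp] at h
  have hdet := C.det_fderiv_lift hT w ζ
  have hr := C.radius_lift T w ζ
  rw [radius, radius, lift_im, div_eq_div_iff (C.D_pos _ _).ne' (C.D_pos _ _).ne'] at hr
  refine mul_right_cancel₀ (mul_pos (Real.exp_pos (2 * ζ.re)) (C.D_pos w (C.angle T w ζ))).ne' ?_
  linear_combination C.D w (C.angle T w ζ) * h + Real.exp (2 * (C.lift T w ζ).re) * hdet + hr

end AngularChart

namespace AngularChart

variable (C : AngularChart) {T : ℝ → ℝ → ℝ}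

theorem lift_of_angle_eq {w : ℝ} {ζ : ℂ} (h : C.angle T w ζ = ζ.im) : C.lift T w ζ = ζ := by
  apply Complex.ext <;> simp [h]

theorem twist_of_eq_zero {w : ℝ} {z : ℂ} (h : T w (C.radius w (Complex.log z)) = 0) :
    C.twist T w z = z := by
  by_cases hz : z = 0
  · simp [hz]
  · rw [twist, if_neg hz, lift_of_angle_eq, Complex.exp_log hz]
    rw [angle, h, add_zero, C.B_A]

theorem twist_of_eq_quarter {w : ℝ} {z : ℂ}
    (h : T w (C.radius w (Complex.log z)) = C.A w (Real.pi / 2)) :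
    C.twist T w z = Complex.I * z := by
  by_cases hz : z = 0
  · simp [hz]
  · have ha : C.angle T w (Complex.log z) = (Complex.log z).im + Real.pi / 2 := by
      rw [angle, h, B_add, C.B_A]
    have hl : C.lift T w (Complex.log z) = Complex.log z + Real.pi / 2 * Complex.I := by
      apply Complex.ext
      · rw [lift_re, ha, C.D_add]; simp
      · rw [lift_im, ha]; simp
    rw [twist, if_neg hz, hl, Complex.exp_add, Complex.exp_log hz, Complex.exp_pi_div_two_mul_I,
      mul_comm]

theorem twist_of_eq_neg_quarter {w : ℝ} {z : ℂ}
    (h : T w (C.radius w (Complex.log z)) = -C.A w (Real.pi / 2)) :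
    C.twist T w z = -Complex.I * z := by
  by_cases hz : z = 0
  · simp [hz]
  · have ha : C.angle T w (Complex.log z) + Real.pi / 2 = (Complex.log z).im := by
      rw [angle, h, ← B_add, neg_add_cancel_right, C.B_A]
    have hl : C.lift T w (Complex.log z) = Complex.log z - Real.pi / 2 * Complex.I := by
      apply Complex.ext
      · rw [lift_re, ← ha, C.D_add]; simp
      · rw [lift_im, eq_sub_of_add_eq ha]; simp
    rw [twist, if_neg hz, hl, Complex.exp_sub, Complex.exp_log hz, Complex.exp_pi_div_two_mul_I,
      Complex.div_I, neg_mul, mul_comm]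

theorem twist_of_flat {w : ℝ} (hA : ∀ θ, C.A w θ = θ) (hD : ∀ θ, C.D w θ = 1) (z : ℂ) :
    C.twist T w z = Complex.exp (T w (Complex.normSq z) * Complex.I) * z := by
  by_cases hz : z = 0
  · simp [hz]
  · have hB : ∀ u, C.B w u = u := fun u => by rw [← hA (C.B w u), C.A_B]
    have hr : C.radius w (Complex.log z) = Complex.normSq z := by
      rw [radius, hD, Complex.log_re, div_one, two_mul, Real.exp_add,
        Real.exp_log (norm_pos_iff.2 hz), Complex.normSq_eq_norm_sq, sq]
    have hl : C.lift T w (Complex.log z) =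
        Complex.log z + T w (Complex.normSq z) * Complex.I := by
      apply Complex.ext
      · simp [hD]
      · simp [angle, hA, hB, hr]
    rw [twist, if_neg hz, hl, Complex.exp_add, Complex.exp_log hz, mul_comm]

theorem radius_log_le (w : ℝ) {z : ℂ} (hz : z ≠ 0) :
    C.radius w (Complex.log z) ≤ ‖z‖ ^ 2 := by
  rw [radius, Complex.log_re, two_mul, Real.exp_add, Real.exp_log (norm_pos_iff.2 hz), sq]
  exact div_le_self (by positivity) (C.one_le_D _ _)

theorem contDiff_twist (hT : ContDiff ℝ (⊤ : ℕ∞) (uncurry T))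
    (hflat : ∀ w ≤ 2 / 3, ∀ θ, C.A w θ = θ ∧ C.D w θ = 1) {σ : ℂ} {r : ℝ} (hr : 0 < r)
    (hcenter : ∀ w > 1 / 3, ∀ z, ‖z‖ < r → C.twist T w z = σ * z) :
    ContDiff ℝ (⊤ : ℕ∞) (uncurry (C.twist T)) := by
  rw [contDiff_iff_contDiffAt]
  rintro ⟨w, z⟩
  by_cases hz : z = 0
  · subst hz
    rcases lt_or_ge w (2 / 3) with hw | hw
    · have hsmooth : ContDiff ℝ (⊤ : ℕ∞) fun p : ℝ × ℂ =>
          Complex.exp (T p.1 (Complex.normSq p.2) * Complex.I) * p.2 := by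
        have hre : ContDiff ℝ (⊤ : ℕ∞) fun p : ℝ × ℂ => p.2.re :=
          Complex.reCLM.contDiff.comp contDiff_snd
        have him : ContDiff ℝ (⊤ : ℕ∞) fun p : ℝ × ℂ => p.2.im :=
          Complex.imCLM.contDiff.comp contDiff_snd
        have hn : ContDiff ℝ (⊤ : ℕ∞) fun p : ℝ × ℂ => Complex.normSq p.2 :=
          (hre.mul hre).add (him.mul him)
        exact (Complex.contDiff_exp.comp ((Complex.ofRealCLM.contDiff.comp
          (hT.comp (contDiff_fst.prodMk hn))).mul contDiff_const)).mul contDiff_snd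
      refine hsmooth.contDiffAt.congr_of_eventuallyEq ?_
      filter_upwards [(isOpen_Iio.preimage continuous_fst).mem_nhds
        (show (w, (0 : ℂ)) ∈ Prod.fst ⁻¹' Iio (2 / 3 : ℝ) from hw)] with p hp
      exact C.twist_of_flat (fun θ => (hflat p.1 (le_of_lt hp) θ).1)
        (fun θ => (hflat p.1 (le_of_lt hp) θ).2) p.2
    · have hsmooth : ContDiff ℝ (⊤ : ℕ∞) fun p : ℝ × ℂ => σ * p.2 :=
        contDiff_const.mul contDiff_snd
      refine hsmooth.contDiffAt.congr_of_eventuallyEq ?_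
      filter_upwards [(isOpen_Ioi.preimage continuous_fst).mem_nhds
        (show (w, (0 : ℂ)) ∈ Prod.fst ⁻¹' Ioi (1 / 3 : ℝ) from by
          simp only [mem_preimage, mem_Ioi]; linarith),
        (Metric.isOpen_ball.preimage continuous_snd).mem_nhds
        (show (w, (0 : ℂ)) ∈ Prod.snd ⁻¹' Metric.ball (0 : ℂ) r by simpa using hr)] with p hp hp'
      exact hcenter p.1 hp p.2 (by simpa using hp')
  · exact C.contDiffAt_twist hT hz

end AngularChart

theorem exists_angularChart {g : ℝ → ℝ} (hg : ContDiff ℝ (⊤ : ℕ∞) g) (hg1 : ∀ θ, 1 ≤ g θ)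
    (hper : Periodic g (Real.pi / 2)) :
    ∃ C : AngularChart, (∀ w ≤ 2 / 3, ∀ θ, C.A w θ = θ ∧ C.D w θ = 1) ∧
      (∀ w θ, C.D w θ ≤ g θ) ∧ ∀ w ≥ 1, ∀ θ, C.D w θ = g θ := by
  have hderiv : ∀ θ, HasDerivAt (fun θ => ∫ t in (0 : ℝ)..θ, g t) (g θ) θ := fun θ =>
    intervalIntegral.integral_hasDerivAt_right (hg.continuous.intervalIntegrable _ _)
      (hg.continuous.stronglyMeasurableAtFilter _ _) hg.continuous.continuousAt
  have hint : ContDiff ℝ (⊤ : ℕ∞) fun θ => ∫ t in (0 : ℝ)..θ, g t := by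
    rw [contDiff_infty_iff_deriv]
    refine ⟨fun θ => (hderiv θ).differentiableAt, ?_⟩
    rwa [funext fun θ => (hderiv θ).deriv]
  have hadd : ∀ θ, ∫ t in (0 : ℝ)..θ + Real.pi / 2, g t =
      (∫ t in (0 : ℝ)..θ, g t) + ∫ t in (0 : ℝ)..Real.pi / 2, g t := by
    intro θ
    have := hper.intervalIntegral_add_eq θ 0
    rw [zero_add] at this
    rw [← this, intervalIntegral.integral_add_adjacent_intervals] <;>
      exact hg.continuous.intervalIntegrable _ _
  let l : ℝ → ℝ := fun w => Real.smoothTransition (3 * w - 2)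
  have hl : ContDiff ℝ (⊤ : ℕ∞) l :=
    Real.smoothTransition.contDiff.comp ((contDiff_const.mul contDiff_id).sub contDiff_const)
  have hl0 : ∀ w, 0 ≤ l w := fun w => Real.smoothTransition.nonneg _
  have hl1 : ∀ w, l w ≤ 1 := fun w => Real.smoothTransition.le_one _
  let A : ℝ → ℝ → ℝ := fun w θ => θ + l w * ((∫ t in (0 : ℝ)..θ, g t) - θ)
  let D : ℝ → ℝ → ℝ := fun w θ => 1 + l w * (g θ - 1)
  have hA : ContDiff ℝ (⊤ : ℕ∞) (uncurry A) :=
    contDiff_snd.add ((hl.comp contDiff_fst).mul ((hint.comp contDiff_snd).sub contDiff_snd))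
  have hD : ContDiff ℝ (⊤ : ℕ∞) (uncurry D) :=
    contDiff_const.add ((hl.comp contDiff_fst).mul ((hg.comp contDiff_snd).sub contDiff_const))
  have hAD : ∀ w θ, HasDerivAt (A w) (D w θ) θ := fun w θ =>
    (hasDerivAt_id θ).add (((hderiv θ).sub (hasDerivAt_id θ)).const_mul (l w))
  have hD1 : ∀ w θ, 1 ≤ D w θ := fun w θ => by
    have := mul_nonneg (hl0 w) (sub_nonneg.2 (hg1 θ))
    simp only [D]; linarith
  obtain ⟨B, hB, hBA, hAB⟩ := exists_contDiff_fiberwise_inverse hA hAD hD1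
  refine ⟨⟨A, B, D, hA, hB, hD, hAD, hBA, hAB, hD1, fun w θ => ?_, fun w θ => ?_⟩,
    fun w hw θ => ?_, fun w θ => ?_, fun w hw θ => ?_⟩
  · simp only [A, hadd]; ring
  · simp only [D, hper θ]
  · have : l w = 0 := Real.smoothTransition.zero_of_nonpos (by linarith)
    simp [A, D, this]
  · have := mul_le_mul_of_nonneg_right (hl1 w) (sub_nonneg.2 (hg1 θ))
    simp only [D]; linarith
  · have : l w = 1 := Real.smoothTransition.one_of_one_le (by linarith)
    simp [D, this]

/-- A smooth gauge for the square: the star-shaped region `‖z‖ ^ 2 ≤ ρ * g (arg z)` contains the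
square of half-side `a`, and the region `‖z‖ ^ 2 < b ^ 2 * g (arg z)` is contained in the one of
half-side `b`. -/
theorem exists_square_gauge {a b : ℝ} (ha : 0 < a) (hab : a < b) :
    ∃ g : ℝ → ℝ, ∃ ρ : ℝ, ContDiff ℝ (⊤ : ℕ∞) g ∧ (∀ θ, 1 ≤ g θ) ∧ Periodic g (Real.pi / 2) ∧
      0 < ρ ∧ ρ < b ^ 2 ∧
      (∀ z : ℂ, |z.re| ≤ a → |z.im| ≤ a → ‖z‖ ^ 2 / g z.arg ≤ ρ) ∧
      ∀ z : ℂ, (b < |z.re| ∨ b < |z.im|) → b ^ 2 ≤ ‖z‖ ^ 2 / g z.arg := by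
  have hb : 0 < b := ha.trans hab
  obtain ⟨k, hk⟩ := pow_unbounded_of_one_lt 2
    (show 1 < b ^ 2 / a ^ 2 by rw [one_lt_div (by positivity)]; gcongr)
  have hk0 : k ≠ 0 := by rintro rfl; norm_num at hk
  rw [div_pow, lt_div_iff₀ (by positivity)] at hk
  let h : ℝ → ℝ := fun θ => (Real.cos θ ^ 2) ^ k + (Real.sin θ ^ 2) ^ k
  have hpos : ∀ θ, 0 < h θ := by
    intro θ
    rcases eq_or_ne (Real.cos θ) 0 with hc | hc
    · have : Real.sin θ ^ 2 = 1 := by have := Real.sin_sq_add_cos_sq θ; rw [hc] at this; linarith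
      simp [h, hc, this, hk0]
    · exact add_pos_of_pos_of_nonneg (by positivity) (by positivity)
  have hle : ∀ θ, h θ ≤ 1 := by
    intro θ
    have h₁ := pow_le_of_le_one (sq_nonneg (Real.cos θ)) (Real.cos_sq_le_one θ) hk0
    have h₂ := pow_le_of_le_one (sq_nonneg (Real.sin θ)) (Real.sin_sq_le_one θ) hk0
    have := Real.sin_sq_add_cos_sq θ
    simp only [h]; linarith
  have hgauge : ∀ z : ℂ, ‖z‖ ^ 2 / h z.arg ^ (-(k : ℝ)⁻¹) =
      ((z.re ^ 2) ^ k + (z.im ^ 2) ^ k) ^ ((k : ℝ)⁻¹) := by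
    intro z
    rw [Real.rpow_neg (hpos _).le, div_inv_eq_mul]
    have hz : (z.re ^ 2) ^ k + (z.im ^ 2) ^ k = (‖z‖ ^ 2) ^ k * h z.arg := by
      conv_lhs => rw [← Complex.norm_mul_cos_arg z, ← Complex.norm_mul_sin_arg z]
      simp only [h]; ring
    rw [hz, Real.mul_rpow (by positivity) (hpos _).le, Real.pow_rpow_inv_natCast (by positivity) hk0]
  refine ⟨fun θ => h θ ^ (-(k : ℝ)⁻¹), (2 * (a ^ 2) ^ k) ^ ((k : ℝ)⁻¹), ?_, fun θ => ?_,
    fun θ => ?_, by positivity, ?_, fun z hre him => ?_, fun z hz => ?_⟩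
  · exact ContDiff.rpow_const_of_ne (((Real.contDiff_cos.pow 2).pow k).add
      ((Real.contDiff_sin.pow 2).pow k)) fun θ => (hpos θ).ne'
  · exact Real.one_le_rpow_of_pos_of_le_one_of_nonpos (hpos θ) (hle θ) (by simp)
  · simp only [h, Real.cos_add_pi_div_two, Real.sin_add_pi_div_two, neg_sq, add_comm]
  · calc (2 * (a ^ 2) ^ k) ^ ((k : ℝ)⁻¹) < ((b ^ 2) ^ k) ^ ((k : ℝ)⁻¹) :=
          Real.rpow_lt_rpow (by positivity) (by linarith) (by positivity)
      _ = b ^ 2 := Real.pow_rpow_inv_natCast (by positivity) hk0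
  · rw [hgauge]
    refine Real.rpow_le_rpow (by positivity) ?_ (by positivity)
    have h₁ : z.re ^ 2 ≤ a ^ 2 := sq_le_sq' (abs_le.1 hre).1 (abs_le.1 hre).2
    have h₂ : z.im ^ 2 ≤ a ^ 2 := sq_le_sq' (abs_le.1 him).1 (abs_le.1 him).2
    rw [two_mul]
    gcongr
  · rw [hgauge, ← Real.pow_rpow_inv_natCast (sq_nonneg b) hk0]
    refine Real.rpow_le_rpow (by positivity) ?_ (by positivity)
    rcases hz with hz | hz
    · have : b ^ 2 ≤ z.re ^ 2 := by rw [← sq_abs z.re]; gcongr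
      calc (b ^ 2) ^ k ≤ (z.re ^ 2) ^ k := by gcongr
        _ ≤ _ := le_add_of_nonneg_right (by positivity)
    · have : b ^ 2 ≤ z.im ^ 2 := by rw [← sq_abs z.im]; gcongr
      calc (b ^ 2) ^ k ≤ (z.im ^ 2) ^ k := by gcongr
        _ ≤ _ := le_add_of_nonneg_left (by positivity)

/-- A smooth family of area-preserving diffeomorphisms of the plane, all supported in the square of
half-side `b`, joining the identity to a map that rotates the square of half-side `a` by `π / 2`. -/
theorem exists_planar_rotation_family {a b : ℝ} (ha : 0 < a) (hab : a < b) :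
    ∃ F F' : ℝ → ℂ → ℂ, ContDiff ℝ (⊤ : ℕ∞) (uncurry F) ∧ ContDiff ℝ (⊤ : ℕ∞) (uncurry F') ∧
      (∀ w, LeftInverse (F' w) (F w)) ∧ (∀ w, RightInverse (F' w) (F w)) ∧
      (∀ w, MeasurePreserving (F w) volume volume) ∧ (∀ w ≤ 0, ∀ z, F w z = z) ∧
      (∀ w z, (b < |z.re| ∨ b < |z.im|) → F w z = z) ∧
      ∀ w ≥ 1, ∀ z, |z.re| ≤ a → |z.im| ≤ a → F w z = Complex.I * z := by
  obtain ⟨g, ρ, hg, hg1, hper, hρ, hρb, hin, hout⟩ := exists_square_gauge ha hab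
  obtain ⟨C, hflat, hDg, hD⟩ := exists_angularChart hg hg1 hper
  let T : ℝ → ℝ → ℝ := fun w q => Real.smoothTransition (3 * w) *
    Real.smoothTransition ((b ^ 2 - q) / (b ^ 2 - ρ)) * C.A w (Real.pi / 2)
  have hT : ContDiff ℝ (⊤ : ℕ∞) (uncurry T) :=
    ((Real.smoothTransition.contDiff.comp (contDiff_const.mul contDiff_fst)).mul
      (Real.smoothTransition.contDiff.comp
        ((contDiff_const.sub contDiff_snd).div_const _))).mul
      (C.contDiff_A.comp (contDiff_fst.prodMk contDiff_const))
  have hTquarter : ∀ w ≥ 1 / 3, ∀ q ≤ ρ, T w q = C.A w (Real.pi / 2) := by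
    intro w hw q hq
    simp only [T]
    rw [Real.smoothTransition.one_of_one_le (by linarith), Real.smoothTransition.one_of_one_le,
      one_mul, one_mul]
    rw [one_le_div (by linarith)]
    linarith
  have hradius : ∀ w z, z ≠ 0 → ‖z‖ < √ρ → C.radius w (Complex.log z) ≤ ρ := by
    intro w z hz hzρ
    refine (C.radius_log_le w hz).trans ?_
    rw [← Real.sq_sqrt hρ.le]
    gcongr
  have hlog : ∀ w z, z ≠ 0 → C.radius w (Complex.log z) = ‖z‖ ^ 2 / C.D w z.arg := by
    intro w z hz
    rw [AngularChart.radius, Complex.log_re, Complex.log_im, two_mul, Real.exp_add,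
      Real.exp_log (norm_pos_iff.2 hz), sq]
  have hF : ContDiff ℝ (⊤ : ℕ∞) (uncurry (C.twist T)) := by
    refine C.contDiff_twist hT hflat (σ := Complex.I) (Real.sqrt_pos.2 hρ) fun w hw z hz => ?_
    by_cases hz0 : z = 0
    · simp [hz0]
    · exact C.twist_of_eq_quarter (hTquarter w hw.le _ (hradius w z hz0 hz))
  have hF' : ContDiff ℝ (⊤ : ℕ∞) (uncurry (C.twist (-T))) := by
    refine C.contDiff_twist (T := -T) hT.neg hflat (σ := -Complex.I) (Real.sqrt_pos.2 hρ)
      fun w hw z hz => ?_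
    by_cases hz0 : z = 0
    · simp [hz0]
    · exact C.twist_of_eq_neg_quarter
        (congrArg Neg.neg (hTquarter w hw.le _ (hradius w z hz0 hz)))
  have hleft : ∀ w, LeftInverse (C.twist (-T) w) (C.twist T w) := C.twist_neg_twist T
  have hright : ∀ w, RightInverse (C.twist (-T) w) (C.twist T w) := fun w z => by
    simpa using C.twist_neg_twist (-T) w z
  refine ⟨C.twist T, C.twist (-T), hF, hF', hleft, hright, fun w => ?_, fun w hw z => ?_,
    fun w z hz => ?_, fun w hw z hre him => ?_⟩
  · exact measurePreserving_of_det_eq_one (hF.comp (contDiff_const.prodMk contDiff_id))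
      (hF'.comp (contDiff_const.prodMk contDiff_id)) (hleft w) (hright w)
      fun z hz => C.det_fderiv_twist (T := -T) hT.neg w hz
  · refine C.twist_of_eq_zero ?_
    simp [T, Real.smoothTransition.zero_of_nonpos (show 3 * w ≤ 0 by linarith)]
  · have hz0 : z ≠ 0 := by
      rintro rfl
      simp only [Complex.zero_re, Complex.zero_im, abs_zero, or_self] at hz
      linarith
    have hbr : b ^ 2 ≤ C.radius w (Complex.log z) := by
      rw [hlog w z hz0]
      refine (hout z hz).trans (div_le_div_of_nonneg_left (by positivity) (C.D_pos _ _) (hDg _ _))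
    refine C.twist_of_eq_zero ?_
    have : (b ^ 2 - C.radius w (Complex.log z)) / (b ^ 2 - ρ) ≤ 0 :=
      div_nonpos_of_nonpos_of_nonneg (by linarith) (by linarith)
    simp [T, Real.smoothTransition.zero_of_nonpos this]
  · by_cases hz0 : z = 0
    · simp [hz0]
    · refine C.twist_of_eq_quarter (hTquarter w (by linarith) _ ?_)
      rw [hlog w z hz0, hD w hw]
      exact hin z hre him

section PlanarExtension

variable {ι : Type*} [DecidableEq ι] {i j : ι}

/-- The point of the plane given by the coordinates `i` and `j`. -/
def planePart (i j : ι) (x : ι → ℝ) : ℂ := ⟨x i, x j⟩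

/-- Replace the coordinates `i` and `j` of `x` by those of `z`. -/
def setPlanePart (i j : ι) (x : ι → ℝ) (z : ℂ) : ι → ℝ :=
  fun k => if k = i then z.re else if k = j then z.im else x k

/-- Let `F` act on the coordinates `i` and `j`, with parameter a function of the others. -/
def planarExtension (i j : ι) (F : ℝ → ℂ → ℂ) (W : ({k // ¬(k = i ∨ k = j)} → ℝ) → ℝ)
    (x : ι → ℝ) : ι → ℝ :=
  setPlanePart i j x (F (W fun k => x k) (planePart i j x))

theorem setPlanePart_self (x : ι → ℝ) :
    setPlanePart i j x (planePart i j x) = x := by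
  funext k
  simp only [setPlanePart, planePart]
  split_ifs with h₁ h₂ <;> simp [*]

theorem planePart_setPlanePart (hij : i ≠ j) (x : ι → ℝ) (z : ℂ) :
    planePart i j (setPlanePart i j x z) = z := by
  apply Complex.ext <;> simp [planePart, setPlanePart, hij.symm]

theorem setPlanePart_rest (x : ι → ℝ) (z : ℂ) (k : {k // ¬(k = i ∨ k = j)}) :
    setPlanePart i j x z k = x k := by
  obtain ⟨k, hk⟩ := k
  push Not at hk
  simp [setPlanePart, hk.1, hk.2]

theorem setPlanePart_setPlanePart (x : ι → ℝ) (z z' : ℂ) :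
    setPlanePart i j (setPlanePart i j x z) z' = setPlanePart i j x z' := by
  funext k
  simp only [setPlanePart]
  split_ifs <;> rfl

theorem leftInverse_planarExtension (hij : i ≠ j) {F F' : ℝ → ℂ → ℂ}
    (h : ∀ w, LeftInverse (F' w) (F w)) (W : ({k // ¬(k = i ∨ k = j)} → ℝ) → ℝ) :
    LeftInverse (planarExtension i j F' W) (planarExtension i j F W) := by
  intro x
  simp only [planarExtension, planePart_setPlanePart hij, setPlanePart_rest,
    setPlanePart_setPlanePart]
  rw [h, setPlanePart_self]

variable [Fintype ι]

theorem contDiff_planarExtension {F : ℝ → ℂ → ℂ} (hF : ContDiff ℝ (⊤ : ℕ∞) (uncurry F))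
    {W : ({k // ¬(k = i ∨ k = j)} → ℝ) → ℝ} (hW : ContDiff ℝ (⊤ : ℕ∞) W) :
    ContDiff ℝ (⊤ : ℕ∞) (planarExtension i j F W) := by
  have hplane : ContDiff ℝ (⊤ : ℕ∞) (planePart i j) := by
    have : planePart i j = fun x : ι → ℝ => (x i : ℂ) + (x j : ℂ) * Complex.I := by
      funext x
      apply Complex.ext <;> simp [planePart]
    rw [this]
    exact (Complex.ofRealCLM.contDiff.comp (contDiff_apply ℝ ℝ i)).add
      ((Complex.ofRealCLM.contDiff.comp (contDiff_apply ℝ ℝ j)).mul contDiff_const)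
  have hWx : ContDiff ℝ (⊤ : ℕ∞) fun x : ι → ℝ =>
      W (fun k : {k // ¬(k = i ∨ k = j)} => x k) :=
    hW.comp (contDiff_pi.2 fun k => contDiff_apply ℝ ℝ (k : ι))
  have hFx := hF.comp (hWx.prodMk hplane)
  refine contDiff_pi.2 fun k => ?_
  simp only [planarExtension, setPlanePart]
  split_ifs
  · exact Complex.reCLM.contDiff.comp hFx
  · exact Complex.imCLM.contDiff.comp hFx
  · exact contDiff_apply ℝ ℝ k

/-- Separate the coordinates `i` and `j` from the others. -/
theorem exists_plane_split (hij : i ≠ j) :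
    ∃ e : (ι → ℝ) ≃ᵐ ℂ × ({k // ¬(k = i ∨ k = j)} → ℝ), MeasurePreserving e volume volume ∧
      ∀ x, e x = (planePart i j x, fun k : {k // ¬(k = i ∨ k = j)} => x k) := by
  let τ : Fin 2 ≃ {k // k = i ∨ k = j} :=
    Equiv.ofBijective ![⟨i, Or.inl rfl⟩, ⟨j, Or.inr rfl⟩] (by
      constructor
      · intro p q h
        fin_cases p <;> fin_cases q <;> simp_all [Subtype.ext_iff, eq_comm]
      · rintro ⟨k, rfl | rfl⟩
        · exact ⟨0, rfl⟩
        · exact ⟨1, rfl⟩)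
  let plane : ({k // k = i ∨ k = j} → ℝ) ≃ᵐ ℂ :=
    (MeasurableEquiv.piCongrLeft (fun _ => ℝ) τ).symm.trans Complex.measurableEquivPi.symm
  have hplane : MeasurePreserving plane volume volume :=
    ((volume_measurePreserving_piCongrLeft (fun _ => ℝ) τ).symm _).trans
      Complex.volume_preserving_equiv_pi.symm
  refine ⟨(MeasurableEquiv.piEquivPiSubtypeProd (fun _ => ℝ) (fun k => k = i ∨ k = j)).trans
    (plane.prodCongr (MeasurableEquiv.refl _)),
    (volume_preserving_piEquivPiSubtypeProd (fun _ => ℝ) _).trans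
      (hplane.prod (MeasurePreserving.id _)), fun x => ?_⟩
  refine Prod.ext ?_ rfl
  change Complex.measurableEquivPi.symm (fun p => x (τ p)) = planePart i j x
  rw [MeasurableEquiv.symm_apply_eq]
  funext p
  fin_cases p <;> rfl

theorem measurePreserving_planarExtension (hij : i ≠ j) {F : ℝ → ℂ → ℂ}
    (hF : Continuous (uncurry F)) (hFmp : ∀ w, MeasurePreserving (F w) volume volume)
    {W : ({k // ¬(k = i ∨ k = j)} → ℝ) → ℝ} (hW : Continuous W) :
    MeasurePreserving (planarExtension i j F W) volume volume := by
  obtain ⟨e, he, hex⟩ := exists_plane_split hij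
  have hskew := MeasurePreserving.skew_product
    (MeasurePreserving.id (volume : Measure ({k // ¬(k = i ∨ k = j)} → ℝ)))
    (g := fun y z => F (W y) z) (μc := volume) (μd := volume)
    (hF.comp ((hW.comp continuous_fst).prodMk continuous_snd)).measurable
    (Filter.Eventually.of_forall fun y => (hFmp (W y)).map_eq)
  have hswap := (Measure.measurePreserving_swap.comp hskew).comp
    (Measure.measurePreserving_swap (μ := (volume : Measure ℂ)))
  suffices hconj : planarExtension i j F W =
      (e.symm ∘ (Prod.swap ∘ fun p => (id p.1, F (W p.1) p.2)) ∘ Prod.swap) ∘ e by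
    rw [hconj]
    exact ((he.symm e).comp hswap).comp he
  funext x
  rw [comp_apply, comp_apply, eq_comm, MeasurableEquiv.symm_apply_eq, hex, hex]
  simp [planarExtension, planePart_setPlanePart hij, setPlanePart_rest]

end PlanarExtension

/-- For every `ε ∈ (0, 1/4)` and distinct indices `i ≠ j` there is a
smooth measure-preserving diffeomorphism of `ℝ^m` which equals the rotation by `π/2`
in the `xᵢ–xⱼ` plane about the center `(1/2, …, 1/2)` (i.e. `x ↦ (…, 1 − xⱼ, …, xᵢ, …)`)
on `[2ε, 1−2ε]^m` and the identity outside `[ε, 1−ε]^m`. -/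
theorem stmt6 (m : ℕ) (ε : ℝ) (hε0 : 0 < ε) (hε : ε < 1 / 4)
    (i j : Fin m) (hij : i ≠ j) :
    ∃ φ φ' : (Fin m → ℝ) → (Fin m → ℝ),
      ContDiff ℝ (⊤ : ℕ∞) φ ∧ ContDiff ℝ (⊤ : ℕ∞) φ' ∧
      LeftInverse φ' φ ∧ RightInverse φ' φ ∧
      MeasurePreserving φ volume volume ∧
      (∀ x ∈ Icc (fun _ : Fin m => 2 * ε) (fun _ => 1 - 2 * ε),
        φ x = fun k => if k = i then 1 - x j else if k = j then x i else x k) ∧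
      (∀ x ∉ Icc (fun _ : Fin m => ε) (fun _ => 1 - ε), φ x = x) := by
  obtain ⟨F, F', hF, hF', hleft, hright, hmp, hid, hout, hin⟩ :=
    exists_planar_rotation_family (a := 1 / 2 - 2 * ε) (b := 1 / 2 - ε) (by linarith) (by linarith)
  let c : ℂ := ⟨1 / 2, 1 / 2⟩
  let center : (ℝ → ℂ → ℂ) → ℝ → ℂ → ℂ := fun G w z => G w (z - c) + c
  have hcenter : ∀ {G : ℝ → ℂ → ℂ}, ContDiff ℝ (⊤ : ℕ∞) (uncurry G) →
      ContDiff ℝ (⊤ : ℕ∞) (uncurry (center G)) := fun hG =>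
    (hG.comp (contDiff_fst.prodMk (contDiff_snd.sub contDiff_const))).add contDiff_const
  have hinv : ∀ {G G' : ℝ → ℂ → ℂ}, (∀ w, LeftInverse (G' w) (G w)) →
      ∀ w, LeftInverse (center G' w) (center G w) := fun h w z => by
    simp [center, h w (z - c)]
  let bump : ℝ → ℝ := fun y =>
    Real.smoothTransition ((y - ε) / ε) * Real.smoothTransition ((1 - ε - y) / ε)
  have hbump : ContDiff ℝ (⊤ : ℕ∞) bump :=
    (Real.smoothTransition.contDiff.comp ((contDiff_id.sub contDiff_const).div_const _)).mul
      (Real.smoothTransition.contDiff.comp ((contDiff_const.sub contDiff_id).div_const _))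
  have hbump1 : ∀ y, 2 * ε ≤ y → y ≤ 1 - 2 * ε → bump y = 1 := by
    intro y h₁ h₂
    simp only [bump]
    rw [Real.smoothTransition.one_of_one_le, Real.smoothTransition.one_of_one_le, one_mul] <;>
      rw [one_le_div hε0] <;> linarith
  have hbump0 : ∀ y, ¬(ε ≤ y ∧ y ≤ 1 - ε) → bump y = 0 := by
    intro y h
    rcases not_and_or.1 h with h | h
    · have : (y - ε) / ε ≤ 0 := div_nonpos_of_nonpos_of_nonneg (by linarith) hε0.le
      simp [bump, Real.smoothTransition.zero_of_nonpos this]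
    · have : (1 - ε - y) / ε ≤ 0 := div_nonpos_of_nonpos_of_nonneg (by linarith) hε0.le
      simp [bump, Real.smoothTransition.zero_of_nonpos this]
  let W : ({k // ¬(k = i ∨ k = j)} → ℝ) → ℝ := fun y => ∏ k, bump (y k)
  have hW : ContDiff ℝ (⊤ : ℕ∞) W :=
    contDiff_prod fun k _ => hbump.comp (contDiff_apply ℝ ℝ k)
  refine ⟨planarExtension i j (center F) W, planarExtension i j (center F') W,
    contDiff_planarExtension (hcenter hF) hW, contDiff_planarExtension (hcenter hF') hW,
    leftInverse_planarExtension hij (hinv hleft) W,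
    leftInverse_planarExtension hij (hinv hright) W,
    measurePreserving_planarExtension hij (hcenter hF).continuous (fun w => ?_) hW.continuous,
    fun x hx => ?_, fun x hx => ?_⟩
  · exact ((measurePreserving_add_right volume c).comp (hmp w)).comp
      (measurePreserving_sub_right volume c)
  · have hx' : ∀ k, 2 * ε ≤ x k ∧ x k ≤ 1 - 2 * ε := fun k => ⟨hx.1 k, hx.2 k⟩
    have hWx : W (fun k => x k) = 1 :=
      Finset.prod_eq_one fun k _ => hbump1 _ (hx' k).1 (hx' k).2
    have hrot : center F 1 (planePart i j x) = Complex.I * (planePart i j x - c) + c := by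
      refine congrArg (· + c) (hin 1 le_rfl _ ?_ ?_)
      · simp only [planePart, c, Complex.sub_re, abs_le]
        constructor <;> linarith [hx' i]
      · simp only [planePart, c, Complex.sub_im, abs_le]
        constructor <;> linarith [hx' j]
    funext k
    simp only [planarExtension, hWx, hrot, setPlanePart]
    congr 1
    · simp [planePart, c]; ring
    · simp [planePart, c]
  · obtain ⟨k, hk⟩ : ∃ k, ¬(ε ≤ x k ∧ x k ≤ 1 - ε) := by
      by_contra! h
      exact hx ⟨fun k => (h k).1, fun k => (h k).2⟩
    have hfix : center F (W fun k => x k) (planePart i j x) = planePart i j x := by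
      have : F (W fun k => x k) (planePart i j x - c) = planePart i j x - c := by
        by_cases hkij : k = i ∨ k = j
        · apply hout
          have habs : 1 / 2 - ε < |x k - 1 / 2| := by
            rw [lt_abs]
            rcases not_and_or.1 hk with h | h
            · right; linarith
            · left; linarith
          rcases hkij with rfl | rfl
          · left; simpa [planePart, c] using habs
          · right; simpa [planePart, c] using habs
        · exact hid _ (Finset.prod_eq_zero (i := (⟨k, hkij⟩ : {k // ¬(k = i ∨ k = j)}))
            (Finset.mem_univ _) (hbump0 _ hk)).le _
      simp [center, this]
    rw [planarExtension, hfix, setPlanePart_self]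
end
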